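/- arXiv:1706.01769 — 3 statements merged into one kernel-verified Lean document; each statement's English description precedes it below -/
import Mathlib

section
/- Let N be a finite set with |N| = n and v : 2^N → ℝ a TU-game. Define the Banzhaf interaction transform I_B^v(S) = (1/2)^{n−|S|} · Σ_{T ⊆ N} (−1)^{|S \ T|} v(T) and the Hadamard transform H^v(S) = 2^{−n/2} · Σ_{T ⊆ N} (−1)^{|S ∩ T|} v(T). Then for every S ⊆ N, I_B^v(S) = ((−2)^{|S|} / 2^{n/2}) · H^v(S). -/
open Finset

/-- The parities of `|S \ T|` and `|S ∩ T|` differ by the parity of `|S|`. -/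
theorem neg_one_pow_card_sdiff {α R : Type*} [DecidableEq α] [Ring R] (S T : Finset α) :
    (-1 : R) ^ (S \ T).card = (-1) ^ S.card * (-1) ^ (S ∩ T).card := by
  rw [← Finset.card_sdiff_add_card_inter S T, pow_add, mul_assoc, ← pow_add,
    Even.neg_one_pow ⟨_, rfl⟩, mul_one]

/-- Relation between the Banzhaf interaction transform
`I_B^v(S) = (1/2)^{n−|S|} Σ_{T ⊆ N} (−1)^{|S \ T|} v(T)` and the Hadamard
transform `H^v(S) = 2^{−n/2} Σ_{T ⊆ N} (−1)^{|S ∩ T|} v(T)` of a TU-game `v`: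
`I_B^v(S) = ((−2)^{|S|} / 2^{n/2}) · H^v(S)` for every coalition `S`. -/
theorem banzhaf_eq_hadamard (N : Type*) [Fintype N] [DecidableEq N]
    (v : Finset N → ℝ) (IB Hv : Finset N → ℝ)
    (hIB : ∀ S : Finset N, IB S =
        ((1 : ℝ) / 2) ^ (Fintype.card N - S.card) *
          ∑ T : Finset N, (-1 : ℝ) ^ ((S \ T).card) * v T)
    (hHv : ∀ S : Finset N, Hv S =
        (∑ T : Finset N, (-1 : ℝ) ^ ((S ∩ T).card) * v T) /
          (2 : ℝ) ^ ((Fintype.card N : ℝ) / 2)) :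
    ∀ S : Finset N,
      IB S = ((-2 : ℝ) ^ S.card / (2 : ℝ) ^ ((Fintype.card N : ℝ) / 2)) * Hv S := by
  intro S
  have hsum : ∑ T : Finset N, (-1 : ℝ) ^ (S \ T).card * v T =
      (-1) ^ S.card * ∑ T : Finset N, (-1 : ℝ) ^ (S ∩ T).card * v T := by
    simp_rw [Finset.mul_sum, neg_one_pow_card_sdiff, mul_assoc]
  have hsqrt : (2 : ℝ) ^ ((Fintype.card N : ℝ) / 2) * (2 : ℝ) ^ ((Fintype.card N : ℝ) / 2) =
      2 ^ Fintype.card N := by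
    rw [← Real.rpow_add two_pos, add_halves, Real.rpow_natCast]
  have hpow : ((1 : ℝ) / 2) ^ (Fintype.card N - S.card) = 2 ^ S.card / 2 ^ Fintype.card N := by
    rw [one_div, inv_pow, pow_sub₀ _ two_ne_zero S.card_le_univ, mul_inv, inv_inv,
      div_eq_inv_mul]
  rw [hIB, hHv, hsum, hpow, div_mul_div_comm, hsqrt, neg_pow (2 : ℝ)]
  ring
end

section
/- Let φ be a linear operator on ℂ^k and a ∈ ℂ^k. Then the following are equivalent: (i) there is some c ∈ ℝ such that ‖φ^t a‖ ≤ c for all t = 0, 1, 2, …; (ii) the limit of the Cesàro averages lim_{t→∞} (1/t) Σ_{m=1}^t φ^m a exists in ℂ^k. -/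
open Filter Finset

section Orbits

variable {V : Type*} [NormedAddCommGroup V] [NormedSpace ℂ V] (T : Module.End ℂ V)

/-- The vectors with bounded orbit under `T`. -/
def boundedOrbitSubmodule : Submodule ℂ V where
  carrier := {v | ∃ c : ℝ, ∀ t : ℕ, ‖(T ^ t) v‖ ≤ c}
  zero_mem' := ⟨0, fun t => by simp⟩
  add_mem' := by
    rintro v w ⟨c, hc⟩ ⟨d, hd⟩
    refine ⟨c + d, fun t => ?_⟩
    rw [map_add]
    exact (norm_add_le _ _).trans (add_le_add (hc t) (hd t))
  smul_mem' := by
    rintro z v ⟨c, hc⟩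
    refine ⟨‖z‖ * c, fun t => ?_⟩
    rw [map_smul, norm_smul]
    exact mul_le_mul_of_nonneg_left (hc t) (norm_nonneg z)

/-- The vectors whose orbit under `T` grows sublinearly. -/
def sublinearOrbitSubmodule : Submodule ℂ V where
  carrier := {v | Tendsto (fun t : ℕ => (t : ℂ)⁻¹ • (T ^ t) v) atTop (nhds 0)}
  zero_mem' := by simp
  add_mem' := by
    intro v w hv hw
    simpa [smul_add] using Tendsto.add hv hw
  smul_mem' := by
    intro z v hv
    have h := Tendsto.const_smul hv z
    rw [smul_zero] at h
    exact h.congr fun t => by rw [map_smul, smul_comm]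

/-- The Cesàro averages of the orbit of `v` under `T`. -/
noncomputable def cesaroAverage (t : ℕ) : Module.End ℂ V :=
  (t : ℂ)⁻¹ • ∑ m ∈ Finset.Icc 1 t, T ^ m

/-- The vectors whose Cesàro averages under `T` converge. -/
noncomputable def meanErgodicSubmodule : Submodule ℂ V where
  carrier := {v | ∃ L : V, Tendsto (fun t : ℕ => cesaroAverage T t v) atTop (nhds L)}
  zero_mem' := ⟨0, by simp⟩
  add_mem' := by
    rintro v w ⟨L, hL⟩ ⟨M, hM⟩
    exact ⟨L + M, by simpa using hL.add hM⟩
  smul_mem' := by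
    rintro z v ⟨L, hL⟩
    exact ⟨z • L, by simpa using hL.const_smul z⟩

variable {T}

lemma cesaroAverage_apply (t : ℕ) (v : V) :
    cesaroAverage T t v = (t : ℂ)⁻¹ • ∑ m ∈ Finset.Icc 1 t, (T ^ m) v := by
  simp [cesaroAverage, LinearMap.sum_apply]

lemma natCast_smul_cesaroAverage_apply (t : ℕ) (v : V) :
    (t : ℂ) • cesaroAverage T t v = ∑ m ∈ Finset.Icc 1 t, (T ^ m) v := by
  rw [cesaroAverage_apply]
  rcases eq_or_ne t 0 with rfl | ht
  · simp
  · rw [smul_inv_smul₀ (Nat.cast_ne_zero.mpr ht)]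

lemma tendsto_natCast_inv_smul_zero (v : V) :
    Tendsto (fun t : ℕ => (t : ℂ)⁻¹ • v) atTop (nhds 0) := by
  simpa using (tendsto_inv_atTop_nhds_zero_nat (𝕜 := ℂ)).smul_const v

lemma pow_apply_of_apply_eq_smul {μ : ℂ} {v : V} (h : T v = μ • v) (t : ℕ) :
    (T ^ t) v = μ ^ t • v := by
  induction t with
  | zero => simp
  | succ t ih => rw [pow_succ', Module.End.mul_apply, ih, map_smul, h, smul_smul, ← pow_succ]

lemma boundedOrbitSubmodule_le_sublinearOrbitSubmodule :
    boundedOrbitSubmodule T ≤ sublinearOrbitSubmodule T := by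
  rintro v ⟨c, hc⟩
  refine squeeze_zero_norm (a := fun t : ℕ => (t : ℝ)⁻¹ * c) (fun t => ?_) ?_
  · rw [norm_smul, norm_inv, Complex.norm_natCast]
    exact mul_le_mul_of_nonneg_left (hc t) (by positivity)
  · simpa using (tendsto_inv_atTop_nhds_zero_nat (𝕜 := ℝ)).mul_const c

lemma meanErgodicSubmodule_le_sublinearOrbitSubmodule :
    meanErgodicSubmodule T ≤ sublinearOrbitSubmodule T := by
  rintro v ⟨L, hL⟩
  refine (tendsto_add_atTop_iff_nat 1).mp ?_
  have hratio : Tendsto (fun t : ℕ => (t : ℂ) / ((t : ℂ) + 1)) atTop (nhds 1) :=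
    tendsto_natCast_div_add_atTop 1
  have h := ((tendsto_add_atTop_iff_nat 1).mpr hL).sub (hratio.smul hL)
  rw [one_smul, sub_self] at h
  refine h.congr fun t => ?_
  rw [div_eq_inv_mul, mul_smul, natCast_smul_cesaroAverage_apply, cesaroAverage_apply,
    Finset.sum_Icc_succ_top (by lia)]
  push_cast
  rw [← smul_sub, add_sub_cancel_left]

/-- An orbit of the shape `μ ^ t • v + t • μ ^ (t - 1) • w` with `1 ≤ ‖μ‖` grows at least linearly
unless `w = 0`. -/
lemma apply_eq_smul_of_sublinear {μ : ℂ} (hμ : 1 ≤ ‖μ‖) {v w : V}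
    (hv : v ∈ sublinearOrbitSubmodule T) (hvw : T v = μ • v + w) (hw : T w = μ • w) : w = 0 := by
  have hμ0 : μ ≠ 0 := norm_pos_iff.mp (one_pos.trans_le hμ)
  have hpow (t : ℕ) : (T ^ t) v = μ ^ t • (v + ((t : ℂ) * μ⁻¹) • w) := by
    induction t with
    | zero => simp
    | succ t ih =>
      rw [pow_succ', Module.End.mul_apply, ih, map_smul, map_add, map_smul, hvw, hw]
      push_cast
      match_scalars <;> field_simp <;> ring
  have hsmall : Tendsto (fun t : ℕ => (t : ℂ)⁻¹ • (v + ((t : ℂ) * μ⁻¹) • w)) atTop (nhds 0) := by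
    refine squeeze_zero_norm (fun t => ?_) (tendsto_zero_iff_norm_tendsto_zero.mp hv)
    rw [hpow, norm_smul, norm_smul, norm_smul, norm_pow]
    gcongr
    exact le_mul_of_one_le_left (norm_nonneg _) (one_le_pow₀ hμ)
  have hlim : Tendsto (fun t : ℕ => (t : ℂ)⁻¹ • (v + ((t : ℂ) * μ⁻¹) • w)) atTop
      (nhds (0 + μ⁻¹ • w)) := by
    refine ((tendsto_natCast_inv_smul_zero v).add_const (μ⁻¹ • w)).congr' ?_
    filter_upwards [eventually_ne_atTop 0] with t ht
    rw [smul_add, mul_smul, inv_smul_smul₀ (Nat.cast_ne_zero.mpr ht)]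
  have := tendsto_nhds_unique hlim hsmall
  rw [zero_add] at this
  exact (smul_eq_zero.mp this).resolve_left (inv_ne_zero hμ0)

lemma eq_zero_of_sublinear_of_one_lt_norm {μ : ℂ} (hμ : 1 < ‖μ‖) {v : V}
    (hv : v ∈ sublinearOrbitSubmodule T) (h : T v = μ • v) : v = 0 := by
  by_contra hv0
  have hlim := (tendsto_zero_iff_norm_tendsto_zero.mp hv).mul_const ‖v‖⁻¹
  have hinv : Tendsto (fun t : ℕ => (t : ℝ) / (‖μ‖ ^ t)) atTop (nhds 0) := by
    simpa using tendsto_pow_const_div_const_pow_of_one_lt 1 hμ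
  have hone := hlim.mul hinv
  rw [zero_mul, zero_mul] at hone
  refine zero_ne_one (tendsto_nhds_unique hone (tendsto_const_nhds.congr' ?_))
  filter_upwards [eventually_ne_atTop 0] with t ht
  have ht' : (t : ℝ) ≠ 0 := Nat.cast_ne_zero.mpr ht
  have hnv : ‖v‖ ≠ 0 := norm_ne_zero_iff.mpr hv0
  have hnμ : ‖μ‖ ≠ 0 := (one_pos.trans hμ).ne'
  rw [pow_apply_of_apply_eq_smul h, norm_smul, norm_smul, norm_inv, norm_pow,
    Complex.norm_natCast]
  field_simp

lemma mem_boundedOrbitSubmodule_of_norm_lt_one {μ : ℂ} (hμ : ‖μ‖ < 1) {v : V}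
    (h : T v - μ • v ∈ boundedOrbitSubmodule T) : v ∈ boundedOrbitSubmodule T := by
  obtain ⟨c, hc⟩ := h
  refine ⟨max ‖v‖ (c / (1 - ‖μ‖)), fun t => ?_⟩
  induction t with
  | zero => simp
  | succ t ih =>
    have hstep : (T ^ (t + 1)) v = μ • (T ^ t) v + (T ^ t) (T v - μ • v) := by
      rw [pow_succ, Module.End.mul_apply, map_sub, map_smul]
      abel
    have hcle : c ≤ max ‖v‖ (c / (1 - ‖μ‖)) * (1 - ‖μ‖) :=
      (div_le_iff₀ (sub_pos.mpr hμ)).mp (le_max_right _ _)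
    calc ‖(T ^ (t + 1)) v‖ ≤ ‖μ‖ * ‖(T ^ t) v‖ + c := by
          rw [hstep]
          refine (norm_add_le _ _).trans (add_le_add (norm_smul _ _).le (hc t))
      _ ≤ ‖μ‖ * max ‖v‖ (c / (1 - ‖μ‖)) + max ‖v‖ (c / (1 - ‖μ‖)) * (1 - ‖μ‖) := by gcongr
      _ = max ‖v‖ (c / (1 - ‖μ‖)) := by ring

lemma mem_boundedOrbitSubmodule_of_apply_eq_smul {μ : ℂ} (hμ : ‖μ‖ = 1) {v : V}
    (h : T v = μ • v) : v ∈ boundedOrbitSubmodule T :=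
  ⟨‖v‖, fun t => by rw [pow_apply_of_apply_eq_smul h, norm_smul, norm_pow, hμ, one_pow, one_mul]⟩

lemma mem_meanErgodicSubmodule_of_apply_eq_self {v : V} (h : T v = v) :
    v ∈ meanErgodicSubmodule T := by
  refine ⟨v, tendsto_const_nhds.congr' ?_⟩
  filter_upwards [eventually_ne_atTop 0] with t ht
  have hpow (m : ℕ) : (T ^ m) v = v := by
    simpa using pow_apply_of_apply_eq_smul (μ := 1) (by simpa using h) m
  simp only [cesaroAverage_apply, hpow, Finset.sum_const, Nat.card_Icc, Nat.add_sub_cancel]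
  rw [← Nat.cast_smul_eq_nsmul ℂ, inv_smul_smul₀ (Nat.cast_ne_zero.mpr ht)]

lemma cesaroAverage_apply_sub (t : ℕ) (v : V) :
    cesaroAverage T t (T v - v) = (t : ℂ)⁻¹ • (T ^ t) (T v) - (t : ℂ)⁻¹ • T v := by
  rw [cesaroAverage_apply, ← smul_sub]
  congr 1
  induction t with
  | zero => simp
  | succ t ih =>
    rw [Finset.sum_Icc_succ_top (by lia), ih, map_sub, pow_succ, Module.End.mul_apply,
      Module.End.mul_apply]
    abel

variable [FiniteDimensional ℂ V]

lemma apply_mem_sublinearOrbitSubmodule {v : V} (hv : v ∈ sublinearOrbitSubmodule T) :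
    T v ∈ sublinearOrbitSubmodule T := by
  have h := (T.continuous_of_finiteDimensional.tendsto 0).comp hv
  rw [map_zero] at h
  refine h.congr fun t => ?_
  simp only [Function.comp_apply, map_smul]
  rw [← Module.End.mul_apply, ← Module.End.mul_apply, ← pow_succ, ← pow_succ']

lemma mem_meanErgodicSubmodule_of_ne_one {μ : ℂ} (hμ : μ ≠ 1) {v : V}
    (hv : v ∈ sublinearOrbitSubmodule T) (h : T v - μ • v ∈ meanErgodicSubmodule T) :
    v ∈ meanErgodicSubmodule T := by
  obtain ⟨L, hL⟩ := h
  have hdiff : Tendsto (fun t : ℕ => cesaroAverage T t (T v - v)) atTop (nhds (0 - 0)) := by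
    simp only [cesaroAverage_apply_sub]
    exact Tendsto.sub (apply_mem_sublinearOrbitSubmodule hv) (tendsto_natCast_inv_smul_zero _)
  refine ⟨_, ((hL.sub hdiff).const_smul (1 - μ)⁻¹).congr fun t => ?_⟩
  have hv' : T v - μ • v - (T v - v) = (1 - μ) • v := by module
  rw [← map_sub, hv', map_smul, inv_smul_smul₀ (sub_ne_zero.mpr hμ.symm)]

/-- To show that a submodule contains every vector with sublinear orbit, it suffices to treat
unimodular eigenvectors and generalized eigenvectors of eigenvalue less than one in modulus. -/
lemma sublinearOrbitSubmodule_le {P : Submodule ℂ V}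
    (hlt : ∀ (μ : ℂ) (v : V), ‖μ‖ < 1 → v ∈ sublinearOrbitSubmodule T → T v - μ • v ∈ P → v ∈ P)
    (heq : ∀ (μ : ℂ) (v : V), ‖μ‖ = 1 → v ∈ sublinearOrbitSubmodule T → T v = μ • v → v ∈ P) :
    sublinearOrbitSubmodule T ≤ P := by
  have hdecomp := Submodule.inf_iSup_genEigenspace (p := sublinearOrbitSubmodule T) (f := T)
    (fun _ hx => apply_mem_sublinearOrbitSubmodule hx) ⊤
  have htop : ⨆ μ, T.genEigenspace μ ⊤ = ⊤ := Module.End.iSup_maxGenEigenspace_eq_top T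
  rw [htop, inf_top_eq] at hdecomp
  rw [hdecomp]
  refine iSup_le fun μ => ?_
  rintro v ⟨hv, hgen⟩
  obtain ⟨n, hn⟩ := (Module.End.mem_maxGenEigenspace T μ v).mp hgen
  clear hgen
  have hpow_succ (n : ℕ) (v : V) : ((T - μ • (1 : Module.End ℂ V)) ^ (n + 1)) v =
      ((T - μ • (1 : Module.End ℂ V)) ^ n) (T v - μ • v) := by
    rw [pow_succ, Module.End.mul_apply]
    simp
  have hsub {v : V} (hv : v ∈ sublinearOrbitSubmodule T) :
      T v - μ • v ∈ sublinearOrbitSubmodule T :=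
    sub_mem (apply_mem_sublinearOrbitSubmodule hv) (Submodule.smul_mem _ _ hv)
  rcases lt_or_ge ‖μ‖ 1 with hμ | hμ
  · induction n generalizing v with
    | zero =>
      rw [show v = 0 by simpa using hn]
      exact zero_mem P
    | succ n ih => exact hlt μ v hμ hv (ih (hsub hv) (by rwa [← hpow_succ]))
  · have heigen : T v = μ • v := by
      induction n generalizing v with
      | zero => simp [show v = 0 by simpa using hn]
      | succ n ih =>
        exact sub_eq_zero.mp (apply_eq_smul_of_sublinear hμ hv (by abel)
          (ih (hsub hv) (by rwa [← hpow_succ])))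
    rcases hμ.eq_or_lt with hμ | hμ
    · exact heq μ v hμ.symm hv heigen
    · rw [eq_zero_of_sublinear_of_one_lt_norm hμ hv heigen]
      exact zero_mem P

lemma boundedOrbitSubmodule_eq_sublinearOrbitSubmodule :
    boundedOrbitSubmodule T = sublinearOrbitSubmodule T :=
  le_antisymm boundedOrbitSubmodule_le_sublinearOrbitSubmodule <|
    sublinearOrbitSubmodule_le
      (fun _ _ hμ _ h => mem_boundedOrbitSubmodule_of_norm_lt_one hμ h)
      (fun _ _ hμ _ h => mem_boundedOrbitSubmodule_of_apply_eq_smul hμ h)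

lemma meanErgodicSubmodule_eq_sublinearOrbitSubmodule :
    meanErgodicSubmodule T = sublinearOrbitSubmodule T := by
  refine le_antisymm meanErgodicSubmodule_le_sublinearOrbitSubmodule
    (sublinearOrbitSubmodule_le (fun μ v hμ hv h => ?_) (fun μ v _ hv h => ?_))
  · exact mem_meanErgodicSubmodule_of_ne_one (fun h1 => by simp [h1] at hμ) hv h
  · rcases eq_or_ne μ 1 with rfl | hμ
    · exact mem_meanErgodicSubmodule_of_apply_eq_self (by rw [h, one_smul])
    · exact mem_meanErgodicSubmodule_of_ne_one hμ hv (by rw [h, sub_self]; exact zero_mem _)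

end Orbits

/-- (Faigle–Schönhuth) For a linear operator `φ` on `ℂ^k` and `a ∈ ℂ^k`, the
orbit `(φ^t a)` is bounded in (Euclidean) norm if and only if the Cesàro
averages `(1/t) Σ_{m=1}^t φ^m a` converge. -/
theorem bounded_iff_mean_ergodic (k : ℕ)
    (φ : Module.End ℂ (EuclideanSpace ℂ (Fin k))) (a : EuclideanSpace ℂ (Fin k)) :
    (∃ c : ℝ, ∀ t : ℕ, ‖(φ ^ t) a‖ ≤ c) ↔
    (∃ L : EuclideanSpace ℂ (Fin k),
        Tendsto (fun t : ℕ => ((t : ℂ))⁻¹ • ∑ m ∈ Finset.Icc 1 t, (φ ^ m) a)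
          atTop (nhds L)) := by
  simp only [← cesaroAverage_apply]
  change a ∈ boundedOrbitSubmodule φ ↔ a ∈ meanErgodicSubmodule φ
  rw [boundedOrbitSubmodule_eq_sublinearOrbitSubmodule,
    meanErgodicSubmodule_eq_sublinearOrbitSubmodule]
end

section
/- Let M ∈ ℝ^{k×k} and let π ∈ ℝ^k be a probability distribution such that for every t ≥ 0 the vector π^{(t)} = M^t π is again a probability distribution (all entries nonnegative and summing to 1). Then the Markov evolution (π^{(t)})_{t≥0} is mean ergodic: the Cesàro averages (1/t) Σ_{m=1}^t M^m π converge in ℝ^k as t → ∞. In particular, every classical homogeneous Markov chain (M a column-stochastic matrix, π a probability distribution) is mean ergodic. -/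
open Filter Finset Matrix

namespace Module.End

variable {E : Type*} [NormedAddCommGroup E] [NormedSpace ℝ E]

/-- The submodule of vectors with bounded orbit under a linear endomorphism. -/
def boundedOrbit (f : Module.End ℝ E) : Submodule ℝ E where
  carrier := {x | ∃ C : ℝ, ∀ n : ℕ, ‖(f ^ n) x‖ ≤ C}
  zero_mem' := ⟨0, fun n => by simp⟩
  add_mem' := by
    rintro x y ⟨C, hC⟩ ⟨D, hD⟩
    refine ⟨C + D, fun n => ?_⟩
    rw [map_add]
    exact (norm_add_le _ _).trans (add_le_add (hC n) (hD n))
  smul_mem' := by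
    rintro c x ⟨C, hC⟩
    refine ⟨‖c‖ * C, fun n => ?_⟩
    rw [map_smul, norm_smul]
    exact mul_le_mul_of_nonneg_left (hC n) (norm_nonneg c)

theorem pow_apply_mem_boundedOrbit {f : Module.End ℝ E} {x : E} (hx : x ∈ boundedOrbit f)
    (m : ℕ) : (f ^ m) x ∈ boundedOrbit f := by
  obtain ⟨C, hC⟩ := hx
  refine ⟨C, fun n => ?_⟩
  rw [← Module.End.mul_apply, ← pow_add]
  exact hC _

/-- The Cesàro average `(1/n) Σ_{i<n} f^i`. -/
noncomputable def cesaro (f : Module.End ℝ E) (n : ℕ) : Module.End ℝ E :=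
  (n : ℝ)⁻¹ • ∑ i ∈ Finset.range n, f ^ i

theorem cesaro_apply (f : Module.End ℝ E) (n : ℕ) (x : E) :
    cesaro f n x = (n : ℝ)⁻¹ • ∑ i ∈ Finset.range n, (f ^ i) x := by
  simp [cesaro, LinearMap.sum_apply]

theorem norm_cesaro_le {f : Module.End ℝ E} {x : E} {C : ℝ} (hC : ∀ n : ℕ, ‖(f ^ n) x‖ ≤ C)
    (n : ℕ) : ‖cesaro f n x‖ ≤ C := by
  rcases Nat.eq_zero_or_pos n with rfl | hn
  · simpa [cesaro] using (norm_nonneg _).trans (hC 0)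
  · have hn' : (0 : ℝ) < n := by exact_mod_cast hn
    have h := norm_sum_le_of_le (Finset.range n) (fun i _ => hC i)
    rw [cesaro_apply, norm_smul, norm_inv, Real.norm_natCast, inv_mul_le_iff₀ hn']
    simpa using h

theorem cesaro_apply_of_fixed {f : Module.End ℝ E} {y : E} (hy : f y = y) {n : ℕ}
    (hn : n ≠ 0) : cesaro f n y = y := by
  have h (i : ℕ) : (f ^ i) y = y := by
    rw [Module.End.pow_apply]
    exact Function.iterate_fixed hy i
  have hn' : (n : ℝ) ≠ 0 := by exact_mod_cast hn
  simp [cesaro_apply, h, ← Nat.cast_smul_eq_nsmul ℝ, smul_smul, hn']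

theorem tendsto_inv_smul_pow_sub {f : Module.End ℝ E} {x : E} (hx : x ∈ boundedOrbit f) :
    Tendsto (fun n : ℕ => (n : ℝ)⁻¹ • ((f ^ n) x - x)) atTop (nhds 0) := by
  obtain ⟨C, hC⟩ := hx
  have h : Tendsto (fun n : ℕ => (n : ℝ)⁻¹ * (C + ‖x‖)) atTop (nhds 0) := by
    simpa using (tendsto_inv_atTop_nhds_zero_nat (𝕜 := ℝ)).mul_const (C + ‖x‖)
  refine squeeze_zero_norm (fun n => ?_) h
  rw [norm_smul, norm_inv, Real.norm_natCast]
  gcongr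
  exact (norm_sub_le _ _).trans (by gcongr; exact hC n)

theorem tendsto_cesaro_apply_sub {f : Module.End ℝ E} {x : E} (hx : x ∈ boundedOrbit f) :
    Tendsto (fun n : ℕ => cesaro f n (f x - x)) atTop (nhds 0) := by
  refine (tendsto_inv_smul_pow_sub hx).congr fun n => ?_
  have h := LinearMap.congr_fun (geom_sum_mul f n) x
  rw [cesaro, LinearMap.smul_apply]
  exact congrArg _ h.symm

theorem tendsto_apply_cesaro_sub {f : Module.End ℝ E} {x : E} (hx : x ∈ boundedOrbit f) :
    Tendsto (fun n : ℕ => f (cesaro f n x) - cesaro f n x) atTop (nhds 0) := by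
  refine (tendsto_inv_smul_pow_sub hx).congr fun n => ?_
  have h := LinearMap.congr_fun (mul_geom_sum f n) x
  rw [cesaro, LinearMap.smul_apply, map_smul, ← smul_sub]
  exact congrArg _ h.symm

theorem cesaro_apply_sub_mem {f : Module.End ℝ E} {x : E} (hx : x ∈ boundedOrbit f) {n : ℕ}
    (hn : n ≠ 0) : cesaro f n x - x ∈ (boundedOrbit f).map (f - 1) := by
  have hn' : (n : ℝ) ≠ 0 := by exact_mod_cast hn
  have h : cesaro f n x - x = (n : ℝ)⁻¹ • ∑ i ∈ Finset.range n, ((f ^ i) x - x) := by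
    simp [cesaro_apply, ← Nat.cast_smul_eq_nsmul ℝ, smul_sub, smul_smul, hn']
  rw [h]
  refine Submodule.smul_mem _ _ (Submodule.sum_mem _ fun i _ => ?_)
  refine ⟨∑ j ∈ Finset.range i, (f ^ j) x,
    Submodule.sum_mem _ fun j _ => pow_apply_mem_boundedOrbit hx j, ?_⟩
  have h := LinearMap.congr_fun (mul_geom_sum f i) x
  simpa [LinearMap.sum_apply] using h

/-- **Mean ergodic theorem** for a single bounded orbit in finite dimension. -/
theorem exists_tendsto_cesaro [FiniteDimensional ℝ E] {f : Module.End ℝ E} {x : E}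
    (hx : x ∈ boundedOrbit f) :
    ∃ y, Tendsto (fun n : ℕ => cesaro f n x) atTop (nhds y) := by
  have : ProperSpace E := FiniteDimensional.proper ℝ E
  have hf : Continuous f := f.continuous_of_finiteDimensional
  obtain ⟨C, hC⟩ := id hx
  obtain ⟨y, -, φ, hφ, hy⟩ := tendsto_subseq_of_bounded
    (Metric.isBounded_closedBall (x := (0 : E)) (r := C))
    (fun n => mem_closedBall_zero_iff.2 (norm_cesaro_le hC n))
  have hfy : f y = y := sub_eq_zero.1 <| tendsto_nhds_unique
    (((hf.tendsto y).comp hy).sub hy)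
    ((tendsto_apply_cesaro_sub hx).comp hφ.tendsto_atTop)
  have hmem : y - x ∈ (boundedOrbit f).map (f - 1) := by
    refine (Submodule.closed_of_finiteDimensional _).mem_of_tendsto (hy.sub_const x) ?_
    filter_upwards [hφ.tendsto_atTop.eventually_ne_atTop 0] with n hn
    exact cesaro_apply_sub_mem hx hn
  obtain ⟨w, hw, hwx⟩ := hmem
  have hwx' : f w - w = y - x := hwx
  refine ⟨y, ?_⟩
  have hlim := (tendsto_cesaro_apply_sub hw).const_sub y
  rw [sub_zero] at hlim
  refine hlim.congr' ?_
  filter_upwards [eventually_ne_atTop 0] with n hn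
  rw [hwx', map_sub, cesaro_apply_of_fixed hfy hn, sub_sub_cancel]

end Module.End

/-- If every iterate `π^{(t)} = M^t π` of a probability distribution `π` under
the matrix `M` is again a probability distribution, then the Markov evolution
`(π^{(t)})` is mean ergodic: the Cesàro averages `(1/t) Σ_{m=1}^t M^m π`
converge. In particular every classical homogeneous Markov chain is mean
ergodic. -/
theorem markov_chain_mean_ergodic (k : ℕ)
    (M : Matrix (Fin k) (Fin k) ℝ) (pi : Fin k → ℝ)
    (hprob : ∀ t : ℕ, (∀ i, 0 ≤ (M ^ t).mulVec pi i) ∧ ∑ i, (M ^ t).mulVec pi i = 1) :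
    ∃ L : Fin k → ℝ,
      Tendsto (fun t : ℕ => ((t : ℝ))⁻¹ • ∑ m ∈ Finset.Icc 1 t, (M ^ m).mulVec pi)
        atTop (nhds L) := by
  have hpow (n : ℕ) (v : Fin k → ℝ) : (Matrix.toLin' M ^ n) v = (M ^ n).mulVec v := by
    rw [← Matrix.toLin'_pow, Matrix.toLin'_apply]
  have hpi : pi ∈ Module.End.boundedOrbit (Matrix.toLin' M) := by
    refine ⟨1, fun n => ?_⟩
    rw [hpow, pi_norm_le_iff_of_nonneg zero_le_one]
    intro i
    rw [Real.norm_of_nonneg ((hprob n).1 i), ← (hprob n).2]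
    exact Finset.single_le_sum (fun j _ => (hprob n).1 j) (Finset.mem_univ i)
  obtain ⟨L, hL⟩ := Module.End.exists_tendsto_cesaro
    (Module.End.pow_apply_mem_boundedOrbit hpi 1)
  refine ⟨L, hL.congr fun t => ?_⟩
  rw [Module.End.cesaro_apply, Finset.range_eq_Ico, ← Finset.Ico_add_one_right_eq_Icc,
    Finset.sum_Ico_eq_sum_range, Finset.sum_Ico_eq_sum_range]
  congr 1
  refine Finset.sum_congr (by simp) fun i _ => ?_
  rw [← Module.End.mul_apply, ← pow_add, hpow]
  congr 2
  omega
end
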